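/- arXiv:2204.02690 — 3 statements merged into one kernel-verified Lean document; each statement's English description precedes it below -/
import Mathlib

section
/- ‖g^k‖ ≤ (M + 2α) ‖x^k − x*‖ + √2 ‖v^k − v*‖. -/
open scoped Kronecker RealInnerProductSpace
open Filter Topology

/-- Spectral norm (ℓ2 operator norm) of a real square matrix. -/
noncomputable def specNorm {ι : Type*} [Fintype ι] [DecidableEq ι] (A : Matrix ι ι ℝ) : ℝ :=
  ‖Matrix.toEuclideanCLM (𝕜 := ℝ) A‖

/-- Action of a matrix on a vector of Euclidean space. -/
noncomputable def mApp {ι : Type*} [Fintype ι] [DecidableEq ι]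
    (A : Matrix ι ι ℝ) (x : EuclideanSpace ℝ ι) : EuclideanSpace ℝ ι :=
  Matrix.toEuclideanCLM (𝕜 := ℝ) A x

/-- Spectral radius of a real square matrix (computed over ℂ). -/
noncomputable def specRad {ι : Type*} [Fintype ι] [DecidableEq ι] (A : Matrix ι ι ℝ) : ℝ :=
  (spectralRadius ℂ (A.map (Complex.ofReal : ℝ → ℂ))).toReal

/-- The matrix 𝕎 = W ⊗ Iₙ. -/
noncomputable def WW (N n : ℕ) (W : Matrix (Fin N) (Fin N) ℝ) :
    Matrix (Fin N × Fin n) (Fin N × Fin n) ℝ :=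
  Matrix.kroneckerMap (· * ·) W (1 : Matrix (Fin n) (Fin n) ℝ)

/-- The i-th block component xᵢ ∈ ℝⁿ of x ∈ ℝ^{nN}. -/
noncomputable def comp (N n : ℕ) (x : EuclideanSpace ℝ (Fin N × Fin n)) (i : Fin N) :
    EuclideanSpace ℝ (Fin n) :=
  (EuclideanSpace.equiv (Fin n) ℝ).symm fun j => x (i, j)

/-- The block-diagonal Hessian ∇²f(x) of f(x) = Σᵢ fᵢ(xᵢ), from local Hessians HF i. -/
noncomputable def blockHess (N n : ℕ)
    (HF : Fin N → EuclideanSpace ℝ (Fin n) → Matrix (Fin n) (Fin n) ℝ)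
    (x : EuclideanSpace ℝ (Fin N × Fin n)) :
    Matrix (Fin N × Fin n) (Fin N × Fin n) ℝ :=
  Matrix.of fun p q =>
    if p.1 = q.1 then HF p.1 (comp N n x p.1) p.2 q.2 else 0

/-- The block norm ‖𝕋‖_b = max_i Σ_j ‖T_{ij}‖₂. -/
noncomputable def blockNorm {N n : ℕ} (T : Matrix (Fin N × Fin n) (Fin N × Fin n) ℝ) : ℝ :=
  ⨆ i : Fin N, ∑ j : Fin N, specNorm (Matrix.of fun (a b : Fin n) => T (i, a) (j, b))

theorem mApp_apply {ι : Type*} [Fintype ι] [DecidableEq ι]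
    (A : Matrix ι ι ℝ) (x : EuclideanSpace ℝ ι) (i : ι) :
    mApp A x i = ∑ j, A i j * x j := rfl

theorem mApp_add {ι : Type*} [Fintype ι] [DecidableEq ι]
    (A : Matrix ι ι ℝ) (x y : EuclideanSpace ℝ ι) : mApp A (x + y) = mApp A x + mApp A y :=
  map_add _ _ _

theorem mApp_sub {ι : Type*} [Fintype ι] [DecidableEq ι]
    (A : Matrix ι ι ℝ) (x y : EuclideanSpace ℝ ι) : mApp A (x - y) = mApp A x - mApp A y :=
  map_sub _ _ _

theorem mApp_smul {ι : Type*} [Fintype ι] [DecidableEq ι]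
    (A : Matrix ι ι ℝ) (c : ℝ) (x : EuclideanSpace ℝ ι) : mApp A (c • x) = c • mApp A x :=
  map_smul _ _ _

theorem mApp_mul {ι : Type*} [Fintype ι] [DecidableEq ι]
    (A B : Matrix ι ι ℝ) (x : EuclideanSpace ℝ ι) : mApp (A * B) x = mApp A (mApp B x) := by
  simp [mApp]

theorem sub_mApp {ι : Type*} [Fintype ι] [DecidableEq ι]
    (A B : Matrix ι ι ℝ) (x : EuclideanSpace ℝ ι) : mApp (A - B) x = mApp A x - mApp B x := by
  simp [mApp]

theorem one_mApp {ι : Type*} [Fintype ι] [DecidableEq ι]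
    (x : EuclideanSpace ℝ ι) : mApp 1 x = x := by
  simp [mApp]

theorem smul_mApp {ι : Type*} [Fintype ι] [DecidableEq ι]
    (c : ℝ) (A : Matrix ι ι ℝ) (x : EuclideanSpace ℝ ι) : mApp (c • A) x = c • mApp A x := by
  simp [mApp]

theorem inner_mApp_symm {ι : Type*} [Fintype ι] [DecidableEq ι] {A : Matrix ι ι ℝ}
    (hA : A.IsHermitian) (x y : EuclideanSpace ℝ ι) :
    inner ℝ (mApp A x) y = inner ℝ x (mApp A y) := by
  have hs (i j : ι) : A i j = A j i := by simpa using (hA.apply i j).symm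
  simp only [PiLp.inner_apply, mApp_apply, RCLike.inner_apply, conj_trivial,
    Finset.mul_sum, Finset.sum_mul]
  rw [Finset.sum_comm]
  refine Finset.sum_congr rfl fun i _ => Finset.sum_congr rfl fun j _ => ?_
  rw [hs i j]
  ring

theorem inner_mApp_self_nonneg {ι : Type*} [Fintype ι] [DecidableEq ι] {A : Matrix ι ι ℝ}
    (hA : A.PosSemidef) (x : EuclideanSpace ℝ ι) : 0 ≤ inner ℝ x (mApp A x) := by
  have h := hA.dotProduct_mulVec_nonneg x.ofLp
  simp only [PiLp.inner_apply, mApp_apply, RCLike.inner_apply, conj_trivial]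
  simp only [dotProduct, Matrix.mulVec, star_trivial] at h
  simpa only [mul_comm] using h

/-- A symmetric matrix with numerical range in `[m, M]`, where `0 < m`, has norm at most `M`. -/
theorem norm_mApp_le_of_posSemidef {ι : Type*} [Fintype ι] [DecidableEq ι] {A : Matrix ι ι ℝ}
    {m M : ℝ} (hm : 0 < m) (hmM : m ≤ M)
    (hlow : (A - m • (1 : Matrix ι ι ℝ)).PosSemidef)
    (hup : (M • (1 : Matrix ι ι ℝ) - A).PosSemidef) (x : EuclideanSpace ℝ ι) :
    ‖mApp A x‖ ≤ M * ‖x‖ := by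
  have hM : 0 < M := hm.trans_le hmM
  have hA : A.IsHermitian := by
    have h := hlow.isHermitian.add
      (Matrix.isHermitian_one.smul (IsSelfAdjoint.all m) : (m • (1 : Matrix ι ι ℝ)).IsHermitian)
    simpa using h
  have hl (z : EuclideanSpace ℝ ι) : 0 ≤ inner ℝ z (mApp A z) := by
    have h := inner_mApp_self_nonneg hlow z
    rw [sub_mApp, smul_mApp, one_mApp, inner_sub_right, inner_smul_right,
      real_inner_self_eq_norm_sq] at h
    nlinarith [sq_nonneg ‖z‖]
  have hu (z : EuclideanSpace ℝ ι) : inner ℝ z (mApp A z) ≤ M * ‖z‖ ^ 2 := by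
    have h := inner_mApp_self_nonneg hup z
    rw [sub_mApp, smul_mApp, one_mApp, inner_sub_right, inner_smul_right,
      real_inner_self_eq_norm_sq] at h
    linarith
  -- polarization: compare the form of `A` at `M x + A x` and at `M x - A x`
  set y := mApp A x with hy
  have h1 := hu (M • x + y)
  have h2 := hl (M • x - y)
  have hxy : inner ℝ x (mApp A y) = ‖y‖ ^ 2 := by
    rw [← inner_mApp_symm hA, ← hy, real_inner_self_eq_norm_sq]
  rw [norm_add_sq_real, mApp_add, mApp_smul, ← hy] at h1
  rw [mApp_sub, mApp_smul, ← hy] at h2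
  simp only [inner_add_left, inner_add_right, inner_sub_left, inner_sub_right,
    inner_smul_left, inner_smul_right, hxy, real_inner_self_eq_norm_sq, norm_smul,
    Real.norm_eq_abs, abs_of_pos hM, conj_trivial] at h1 h2
  have h3 := sq_nonneg ‖M • x - y‖
  rw [norm_sub_sq_real, norm_smul, Real.norm_eq_abs, abs_of_pos hM, inner_smul_left,
    conj_trivial] at h3
  have h4 : M * ‖y‖ ^ 2 ≤ M * (M * ‖x‖) ^ 2 := by
    nlinarith [mul_nonneg hM.le h3]
  exact abs_le_of_sq_le_sq' (le_of_mul_le_mul_left h4 hM) (by positivity) |>.2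

/-- A doubly stochastic matrix is nonexpansive for the Euclidean norm. -/
theorem norm_mApp_le_of_doublyStochastic {ι : Type*} [Fintype ι] [DecidableEq ι]
    {A : Matrix ι ι ℝ} (h0 : ∀ i j, 0 ≤ A i j) (hrow : ∀ i, ∑ j, A i j = 1)
    (hcol : ∀ j, ∑ i, A i j = 1) (x : EuclideanSpace ℝ ι) : ‖mApp A x‖ ≤ ‖x‖ := by
  refine abs_le_of_sq_le_sq' ?_ (norm_nonneg _) |>.2
  rw [EuclideanSpace.real_norm_sq_eq, EuclideanSpace.real_norm_sq_eq]
  calc ∑ i, (mApp A x i) ^ 2 ≤ ∑ i, ∑ j, A i j * x j ^ 2 := by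
        refine Finset.sum_le_sum fun i _ => ?_
        have h := Finset.sum_sq_le_sum_mul_sum_of_sq_le_mul Finset.univ
          (r := fun j => A i j * x j) (f := fun j => A i j) (g := fun j => A i j * x j ^ 2)
          (fun j _ => h0 i j) (fun j _ => mul_nonneg (h0 i j) (sq_nonneg _))
          (fun j _ => le_of_eq (by ring))
        rwa [hrow, one_mul] at h
    _ = ∑ j, x j ^ 2 := by
        rw [Finset.sum_comm]
        simp_rw [← Finset.sum_mul, hcol, one_mul]

theorem norm_mApp_WW_le {N n : ℕ} {W : Matrix (Fin N) (Fin N) ℝ} (h0 : ∀ i j, 0 ≤ W i j)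
    (hrow : ∀ i, ∑ j, W i j = 1) (hcol : ∀ j, ∑ i, W i j = 1)
    (x : EuclideanSpace ℝ (Fin N × Fin n)) : ‖mApp (WW N n W) x‖ ≤ ‖x‖ := by
  refine norm_mApp_le_of_doublyStochastic (fun p q => ?_) (fun p => ?_) (fun q => ?_) x
  · rw [WW, Matrix.kroneckerMap_apply, Matrix.one_apply]
    exact mul_nonneg (h0 _ _) (by split_ifs <;> norm_num)
  · simp [WW, Fintype.sum_prod_type, Matrix.one_apply, hrow]
  · simp [WW, Fintype.sum_prod_type, Matrix.one_apply, hcol]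

theorem norm_mApp_one_sub_WW_le {N n : ℕ} {W : Matrix (Fin N) (Fin N) ℝ}
    (h0 : ∀ i j, 0 ≤ W i j) (hrow : ∀ i, ∑ j, W i j = 1) (hcol : ∀ j, ∑ i, W i j = 1)
    (x : EuclideanSpace ℝ (Fin N × Fin n)) : ‖mApp (1 - WW N n W) x‖ ≤ 2 * ‖x‖ := by
  rw [sub_mApp, one_mApp]
  linarith [norm_sub_le x (mApp (WW N n W) x), norm_mApp_WW_le h0 hrow hcol x]

/-- The block components as a continuous linear map. -/
noncomputable def compCLM (N n : ℕ) (i : Fin N) :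
    EuclideanSpace ℝ (Fin N × Fin n) →L[ℝ] EuclideanSpace ℝ (Fin n) :=
  LinearMap.toContinuousLinearMap
    { toFun := fun x => comp N n x i
      map_add' := fun _ _ => rfl
      map_smul' := fun _ _ => rfl }

theorem norm_sq_eq_sum_comp {N n : ℕ} (x : EuclideanSpace ℝ (Fin N × Fin n)) :
    ‖x‖ ^ 2 = ∑ i, ‖comp N n x i‖ ^ 2 := by
  simp only [EuclideanSpace.real_norm_sq_eq, Fintype.sum_prod_type]
  rfl

theorem inner_eq_sum_comp {N n : ℕ} (x y : EuclideanSpace ℝ (Fin N × Fin n)) :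
    inner ℝ x y = ∑ i, inner ℝ (comp N n x i) (comp N n y i) := by
  simp only [PiLp.inner_apply, Fintype.sum_prod_type]
  rfl

theorem comp_gradient_sum {N n : ℕ} {F : Fin N → EuclideanSpace ℝ (Fin n) → ℝ}
    (hF : ∀ i, Differentiable ℝ (F i)) {f : EuclideanSpace ℝ (Fin N × Fin n) → ℝ}
    (hf : ∀ x, f x = ∑ i, F i (comp N n x i)) (x : EuclideanSpace ℝ (Fin N × Fin n))
    (i : Fin N) : comp N n (gradient f x) i = gradient (F i) (comp N n x i) := by
  let G : EuclideanSpace ℝ (Fin N × Fin n) :=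
    WithLp.toLp 2 fun p => gradient (F p.1) (comp N n x p.1) p.2
  have hG : HasGradientAt f G x := by
    rw [hasGradientAt_iff_hasFDerivAt]
    have h : HasFDerivAt (fun z => ∑ i, F i (compCLM N n i z))
        (∑ i, (InnerProductSpace.toDual ℝ _ (gradient (F i) (comp N n x i))).comp
          (compCLM N n i)) x :=
      HasFDerivAt.fun_sum fun i _ =>
        ((hF i (comp N n x i)).hasGradientAt.hasFDerivAt).comp x (compCLM N n i).hasFDerivAt
    have hf' : f = fun z => ∑ i, F i (compCLM N n i z) := funext hf
    rw [hf']
    refine h.congr_fderiv (ContinuousLinearMap.ext fun v => ?_)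
    rw [InnerProductSpace.toDual_apply_apply, inner_eq_sum_comp, sum_apply]
    rfl
  rw [hG.gradient]
  rfl

/-- The gradient of a separable function with Hessians in `[m, M]` is `M`-Lipschitz. -/
theorem norm_gradient_sub_le {N n : ℕ} {m M : ℝ} (hm : 0 < m) (hmM : m ≤ M)
    {F : Fin N → EuclideanSpace ℝ (Fin n) → ℝ} (hF : ∀ i, Differentiable ℝ (F i))
    {HF : Fin N → EuclideanSpace ℝ (Fin n) → Matrix (Fin n) (Fin n) ℝ}
    (hHF : ∀ i y, HasFDerivAt (gradient (F i)) (Matrix.toEuclideanCLM (𝕜 := ℝ) (HF i y)) y)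
    (hlow : ∀ i y, (HF i y - m • (1 : Matrix (Fin n) (Fin n) ℝ)).PosSemidef)
    (hup : ∀ i y, (M • (1 : Matrix (Fin n) (Fin n) ℝ) - HF i y).PosSemidef)
    {f : EuclideanSpace ℝ (Fin N × Fin n) → ℝ}
    (hf : ∀ x, f x = ∑ i, F i (comp N n x i)) (x y : EuclideanSpace ℝ (Fin N × Fin n)) :
    ‖gradient f x - gradient f y‖ ≤ M * ‖x - y‖ := by
  have hM : 0 < M := hm.trans_le hmM
  refine abs_le_of_sq_le_sq' ?_ (by positivity) |>.2
  rw [mul_pow, norm_sq_eq_sum_comp, norm_sq_eq_sum_comp, Finset.mul_sum]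
  refine Finset.sum_le_sum fun i _ => ?_
  change ‖comp N n (gradient f x) i - comp N n (gradient f y) i‖ ^ 2 ≤
    M ^ 2 * ‖comp N n x i - comp N n y i‖ ^ 2
  rw [comp_gradient_sum hF hf, comp_gradient_sum hF hf, ← mul_pow]
  gcongr
  exact convex_univ.norm_image_sub_le_of_norm_hasFDerivWithin_le
    (fun z _ => (hHF i z).hasFDerivWithinAt)
    (fun z _ => ContinuousLinearMap.opNorm_le_bound _ hM.le
      (norm_mApp_le_of_posSemidef hm hmM (hlow i z) (hup i z)))
    (Set.mem_univ _) (Set.mem_univ _)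

theorem stmt3
    (N n : ℕ) (hN : 1 ≤ N) (hn : 1 ≤ n)
    (W : Matrix (Fin N) (Fin N) ℝ)
    (hWsymm : W.IsSymm)
    (hWnonneg : ∀ i j, 0 ≤ W i j)
    (hWrow : ∀ i, ∑ j, W i j = 1)
    (hWcol : ∀ j, ∑ i, W i j = 1)
    (hWdiagpos : ∀ i, 0 < W i i)
    (m M : ℝ) (hm : 0 < m) (hmM : m ≤ M)
    (F : Fin N → EuclideanSpace ℝ (Fin n) → ℝ)
    (hFsmooth : ∀ i, ContDiff ℝ 2 (F i))
    (HF : Fin N → EuclideanSpace ℝ (Fin n) → Matrix (Fin n) (Fin n) ℝ)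
    (hHF : ∀ i y, HasFDerivAt (gradient (F i)) (Matrix.toEuclideanCLM (𝕜 := ℝ) (HF i y)) y)
    (hHFlow : ∀ i y, (HF i y - m • (1 : Matrix (Fin n) (Fin n) ℝ)).PosSemidef)
    (hHFup : ∀ i y, (M • (1 : Matrix (Fin n) (Fin n) ℝ) - HF i y).PosSemidef)
    (f : EuclideanSpace ℝ (Fin N × Fin n) → ℝ)
    (hf : ∀ x, f x = ∑ i, F i (comp N n x i))
    (S : Matrix (Fin N × Fin n) (Fin N × Fin n) ℝ)
    (hSpsd : S.PosSemidef)
    (hSsq : S * S = 1 - WW N n W)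
    (xstar vstar : EuclideanSpace ℝ (Fin N × Fin n))
    (hopt1 : gradient f xstar + mApp S vstar = 0)
    (hopt2 : mApp S xstar = 0)
    (α : ℝ) (hα : 0 < α)
    (xk vk : EuclideanSpace ℝ (Fin N × Fin n))
    (qk : EuclideanSpace ℝ (Fin N × Fin n)) (hqk : qk = mApp S vk)
    (gk : EuclideanSpace ℝ (Fin N × Fin n))
    (hgk : gk = gradient f xk + qk + α • mApp (1 - WW N n W) xk)
 :
    ‖gk‖ ≤ (M + 2 * α) * ‖xk - xstar‖ + Real.sqrt 2 * ‖vk - vstar‖ := by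
  have hgrad := norm_gradient_sub_le hm hmM (fun i => (hFsmooth i).differentiable (by norm_num))
    hHF hHFlow hHFup hf xk xstar
  have hWx := norm_mApp_one_sub_WW_le (n := n) hWnonneg hWrow hWcol (xk - xstar)
  have hWv := norm_mApp_one_sub_WW_le (n := n) hWnonneg hWrow hWcol (vk - vstar)
  have hS : ‖mApp S (vk - vstar)‖ ≤ Real.sqrt 2 * ‖vk - vstar‖ := by
    refine abs_le_of_sq_le_sq' ?_ (by positivity) |>.2
    rw [mul_pow, Real.sq_sqrt (by norm_num), ← real_inner_self_eq_norm_sq,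
      inner_mApp_symm hSpsd.isHermitian, ← mApp_mul, hSsq]
    nlinarith [real_inner_le_norm (vk - vstar) (mApp (1 - WW N n W) (vk - vstar)),
      norm_nonneg (vk - vstar)]
  have hxstar : mApp (1 - WW N n W) xstar = 0 := by
    rw [← hSsq, mApp_mul, hopt2]
    exact map_zero _
  have hdecomp : gk = (gradient f xk - gradient f xstar) + mApp S (vk - vstar) +
      α • mApp (1 - WW N n W) (xk - xstar) := by
    rw [hgk, hqk, mApp_sub, mApp_sub, hxstar, eq_neg_of_add_eq_zero_left hopt1]
    module
  have hαW : ‖α • mApp (1 - WW N n W) (xk - xstar)‖ ≤ α * (2 * ‖xk - xstar‖) := by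
    rw [norm_smul, Real.norm_of_nonneg hα.le]
    gcongr
  rw [hdecomp]
  linarith [norm_add₃_le (a := gradient f xk - gradient f xstar) (b := mApp S (vk - vstar))
    (c := α • mApp (1 - WW N n W) (xk - xstar))]
end

section
/- For all β > 1 and φ > 1: ‖v^{k+1} − v*‖² ≤ (β ε² / ((β − 1) λ₂)) ‖d^k‖² + (φ β / λ₂) ‖∇f(x^{k+1}) − ∇f(x*)‖² + (β φ / ((φ − 1) λ₂)) ‖e^k‖². -/
open scoped Kronecker RealInnerProductSpace
open Filter Topology

theorem inner_mApp_comm {ι : Type*} [Fintype ι] [DecidableEq ι] {A : Matrix ι ι ℝ}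
    (hA : A.IsHermitian) (x y : EuclideanSpace ℝ ι) : ⟪mApp A x, y⟫ = ⟪x, mApp A y⟫ :=
  Matrix.isSymmetric_toEuclideanLin_iff.mpr hA x y

/-- A symmetric matrix is bounded below, on the orthogonal complement of its kernel, by any
lower bound for its nonzero eigenvalues. -/
theorem mul_norm_sq_le_inner_mApp {ι : Type*} [Fintype ι] [DecidableEq ι] {A : Matrix ι ι ℝ}
    (hA : A.IsHermitian) {c : ℝ} (hc : ∀ μ ∈ spectrum ℝ A, μ ≠ 0 → c ≤ μ)
    {u : EuclideanSpace ℝ ι} (hu : ∀ z, mApp A z = 0 → ⟪u, z⟫ = 0) :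
    c * ‖u‖ ^ 2 ≤ ⟪u, mApp A u⟫ := by
  have heig (i : ι) : mApp A (hA.eigenvectorBasis i) =
      hA.eigenvalues i • hA.eigenvectorBasis i := by
    ext j
    exact congrFun (hA.mulVec_eigenvectorBasis i) j
  rw [← real_inner_self_eq_norm_sq, ← hA.eigenvectorBasis.sum_inner_mul_inner u u,
    ← hA.eigenvectorBasis.sum_inner_mul_inner u (mApp A u), Finset.mul_sum]
  refine Finset.sum_le_sum fun i _ => ?_
  rw [← inner_mApp_comm hA, heig, real_inner_smul_left,
    real_inner_comm u (hA.eigenvectorBasis i)]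
  by_cases h0 : hA.eigenvalues i = 0
  · have : ⟪u, hA.eigenvectorBasis i⟫ = 0 := hu _ (by rw [heig, h0, zero_smul])
    simp [this]
  · nlinarith [hc _ (hA.eigenvalues_mem_spectrum_real i) h0,
      mul_self_nonneg ⟪u, hA.eigenvectorBasis i⟫]

/-- Young's inequality for the square of the norm of a sum. -/
theorem norm_add_sq_le_of_one_lt {E : Type*} [SeminormedAddCommGroup E]
    {t : ℝ} (ht : 1 < t) (a b : E) :
    ‖a + b‖ ^ 2 ≤ t * ‖a‖ ^ 2 + t / (t - 1) * ‖b‖ ^ 2 := by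
  have h : 0 < t - 1 := sub_pos.mpr ht
  have key : t * ‖a‖ ^ 2 + t / (t - 1) * ‖b‖ ^ 2 - (‖a‖ + ‖b‖) ^ 2 =
      ((t - 1) * ‖a‖ - ‖b‖) ^ 2 / (t - 1) := by
    field_simp
    ring
  have hpos : 0 ≤ ((t - 1) * ‖a‖ - ‖b‖) ^ 2 / (t - 1) := by positivity
  have htri : ‖a + b‖ ^ 2 ≤ (‖a‖ + ‖b‖) ^ 2 := by
    gcongr
    exact norm_add_le a b
  linarith

theorem stmt6
    (N n : ℕ) (hN : 1 ≤ N) (hn : 1 ≤ n)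
    (W : Matrix (Fin N) (Fin N) ℝ)
    (hWsymm : W.IsSymm)
    (hWnonneg : ∀ i j, 0 ≤ W i j)
    (hWrow : ∀ i, ∑ j, W i j = 1)
    (hWcol : ∀ j, ∑ i, W i j = 1)
    (hWdiagpos : ∀ i, 0 < W i i)
    (m M : ℝ) (hm : 0 < m) (hmM : m ≤ M)
    (F : Fin N → EuclideanSpace ℝ (Fin n) → ℝ)
    (hFsmooth : ∀ i, ContDiff ℝ 2 (F i))
    (HF : Fin N → EuclideanSpace ℝ (Fin n) → Matrix (Fin n) (Fin n) ℝ)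
    (hHF : ∀ i y, HasFDerivAt (gradient (F i)) (Matrix.toEuclideanCLM (𝕜 := ℝ) (HF i y)) y)
    (hHFlow : ∀ i y, (HF i y - m • (1 : Matrix (Fin n) (Fin n) ℝ)).PosSemidef)
    (hHFup : ∀ i y, (M • (1 : Matrix (Fin n) (Fin n) ℝ) - HF i y).PosSemidef)
    (f : EuclideanSpace ℝ (Fin N × Fin n) → ℝ)
    (hf : ∀ x, f x = ∑ i, F i (comp N n x i))
    (Hf : EuclideanSpace ℝ (Fin N × Fin n) → Matrix (Fin N × Fin n) (Fin N × Fin n) ℝ)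
    (hHfderiv : ∀ x, HasFDerivAt (gradient f) (Matrix.toEuclideanCLM (𝕜 := ℝ) (Hf x)) x)
    (S : Matrix (Fin N × Fin n) (Fin N × Fin n) ℝ)
    (hSpsd : S.PosSemidef)
    (hSsq : S * S = 1 - WW N n W)
    (xstar vstar : EuclideanSpace ℝ (Fin N × Fin n))
    (hopt1 : gradient f xstar + mApp S vstar = 0)
    (hopt2 : mApp S xstar = 0)
    (α ε : ℝ) (hα : 0 < α) (hε : 0 < ε)
    (xk vk : EuclideanSpace ℝ (Fin N × Fin n))
    (qk : EuclideanSpace ℝ (Fin N × Fin n)) (hqk : qk = mApp S vk)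
    (gk : EuclideanSpace ℝ (Fin N × Fin n))
    (hgk : gk = gradient f xk + qk + α • mApp (1 - WW N n W) xk)
    (Hk : Matrix (Fin N × Fin n) (Fin N × Fin n) ℝ)
    (hHk : Hk = Hf xk + α • ((1 : Matrix (Fin N × Fin n) (Fin N × Fin n) ℝ) - WW N n W) + ε • 1)
    (dk rk : EuclideanSpace ℝ (Fin N × Fin n))
    (hstep : mApp Hk dk = -gk + rk)
    (xk1 : EuclideanSpace ℝ (Fin N × Fin n)) (hx1 : xk1 = xk + dk)
    (vk1 : EuclideanSpace ℝ (Fin N × Fin n)) (hv1 : vk1 = vk + α • mApp S xk1)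
    (qk1 : EuclideanSpace ℝ (Fin N × Fin n)) (hq1 : qk1 = qk + α • mApp (1 - WW N n W) xk1)
    (ek : EuclideanSpace ℝ (Fin N × Fin n))
    (hek : ek = mApp (Hf xk) dk + gradient f xk - gradient f xk1 - rk)
    (lam2 : ℝ) (hlam2pos : 0 < lam2)
    (hWneI : W ≠ 1)
    (hlam2mem : lam2 ∈ spectrum ℝ ((1 : Matrix (Fin N × Fin n) (Fin N × Fin n) ℝ) - WW N n W))
    (hlam2min : ∀ μ ∈ spectrum ℝ ((1 : Matrix (Fin N × Fin n) (Fin N × Fin n) ℝ) - WW N n W),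
      μ ≠ 0 → lam2 ≤ μ)
    (horth : ∀ z : EuclideanSpace ℝ (Fin N × Fin n),
      mApp (1 - WW N n W) z = 0 → ⟪vk1 - vstar, z⟫ = 0)
 :
    ∀ β φ : ℝ, 1 < β → 1 < φ →
      ‖vk1 - vstar‖ ^ 2 ≤ (β * ε ^ 2 / ((β - 1) * lam2)) * ‖dk‖ ^ 2
        + (φ * β / lam2) * ‖gradient f xk1 - gradient f xstar‖ ^ 2
        + (β * φ / ((φ - 1) * lam2)) * ‖ek‖ ^ 2 := by
  intro β φ hβ hφ
  have hres : mApp S (vk1 - vstar) =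
      -((gradient f xk1 - gradient f xstar) + ek + ε • dk) := by
    rw [hHk] at hstep
    have hSS : mApp S (mApp S xk1) = mApp (1 - WW N n W) xk1 := by
      rw [← hSsq, mApp_mul]
    rw [hx1] at hSS
    subst hek hv1 hx1 hgk hqk
    simp only [mApp, map_add, map_sub, map_smul, map_one, add_apply, smul_apply,
      sub_apply, one_apply_eq_self] at hstep hSS hopt1 ⊢
    linear_combination (norm := module) hstep - hopt1 + α • hSS
  have hA : (1 - WW N n W).IsHermitian := by
    rw [← hSsq, Matrix.IsHermitian, Matrix.conjTranspose_mul, hSpsd.isHermitian.eq]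
  have hgap := mul_norm_sq_le_inner_mApp hA hlam2min horth
  rw [← hSsq, mApp_mul, ← inner_mApp_comm hSpsd.isHermitian, real_inner_self_eq_norm_sq, hres,
    norm_neg] at hgap
  have hβ' : 0 < β - 1 := sub_pos.mpr hβ
  have hφ' : 0 < φ - 1 := sub_pos.mpr hφ
  have houter := norm_add_sq_le_of_one_lt hβ
    ((gradient f xk1 - gradient f xstar) + ek) (ε • dk)
  have hinner := mul_le_mul_of_nonneg_left
    (norm_add_sq_le_of_one_lt hφ (gradient f xk1 - gradient f xstar) ek)
    (zero_le_one.trans hβ.le)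
  rw [norm_smul, Real.norm_of_nonneg hε.le] at houter
  refine le_of_mul_le_mul_left ?_ hlam2pos
  calc lam2 * ‖vk1 - vstar‖ ^ 2
      ≤ β * (φ * ‖gradient f xk1 - gradient f xstar‖ ^ 2 + φ / (φ - 1) * ‖ek‖ ^ 2)
        + β / (β - 1) * (ε * ‖dk‖) ^ 2 := by linarith
    _ = _ := by
      field_simp
      ring
end

section
/- ‖𝔻^{-1} ℍ‖_b ≤ (M + ε + α(1 − w_m) + α(1 − w_d)) / (m + α(1 − w_d) + ε). -/
open scoped Kronecker RealInnerProductSpace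
open Filter Topology

theorem specNorm_mul_le {ι : Type*} [Fintype ι] [DecidableEq ι] (A B : Matrix ι ι ℝ) :
    specNorm (A * B) ≤ specNorm A * specNorm B := by
  simp only [specNorm, map_mul]
  exact norm_mul_le _ _

open scoped Matrix.Norms.L2Operator in
theorem specNorm_diagonal_le {ι : Type*} [Fintype ι] [DecidableEq ι] {v : ι → ℝ} {c : ℝ}
    (hc : 0 ≤ c) (hv : ∀ i, |v i| ≤ c) : specNorm (Matrix.diagonal v) ≤ c := by
  rw [specNorm, Matrix.l2_opNorm_toEuclideanCLM, Matrix.l2_opNorm_diagonal]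
  exact (pi_norm_le_iff_of_nonneg hc).2 hv

theorem specNorm_le_of_posSemidef {ι : Type*} [Fintype ι] [DecidableEq ι] {A : Matrix ι ι ℝ}
    {c : ℝ} (hc : 0 ≤ c) (hA : A.PosSemidef) (hAc : (c • 1 - A).PosSemidef) :
    specNorm A ≤ c := by
  have hsymm : (Matrix.toEuclideanCLM (𝕜 := ℝ) A).toLinearMap.IsSymmetric := by
    rw [Matrix.coe_toEuclideanCLM_eq_toEuclideanLin]
    exact Matrix.isSymmetric_toEuclideanLin_iff.2 hA.isHermitian
  rw [specNorm, ContinuousLinearMap.norm_eq_iSup_rayleighQuotient _ hsymm]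
  refine ciSup_le fun x => ?_
  have h₀ := hA.dotProduct_mulVec_nonneg x.ofLp
  have h₁ := hAc.dotProduct_mulVec_nonneg x.ofLp
  have hinner : (Matrix.toEuclideanCLM (𝕜 := ℝ) A).reApplyInnerSelf x
      = x.ofLp ⬝ᵥ A.mulVec x.ofLp := by
    rw [ContinuousLinearMap.reApplyInnerSelf_apply, real_inner_comm, Matrix.inner_toEuclideanCLM]
    simp
  have hnorm : ‖x‖ ^ 2 = x.ofLp ⬝ᵥ x.ofLp := by
    rw [EuclideanSpace.real_norm_sq_eq]
    simp only [dotProduct, sq]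
  simp only [star_trivial, Matrix.sub_mulVec, Matrix.smul_mulVec, Matrix.one_mulVec,
    dotProduct_sub, dotProduct_smul, smul_eq_mul] at h₀ h₁
  rw [ContinuousLinearMap.rayleighQuotient, hinner, abs_div, abs_of_nonneg h₀, abs_sq, hnorm]
  exact div_le_of_le_mul₀ (hnorm ▸ sq_nonneg _) hc (by linarith)

theorem specNorm_smul_one_le {ι : Type*} [Fintype ι] [DecidableEq ι] (c : ℝ) :
    specNorm (c • (1 : Matrix ι ι ℝ)) ≤ |c| := by
  rw [Matrix.smul_one_eq_diagonal]
  exact specNorm_diagonal_le (abs_nonneg c) fun _ => le_rfl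

theorem stmt9
    (N n : ℕ) (hN : 1 ≤ N) (hn : 1 ≤ n)
    (W : Matrix (Fin N) (Fin N) ℝ)
    (hWsymm : W.IsSymm)
    (hWnonneg : ∀ i j, 0 ≤ W i j)
    (hWrow : ∀ i, ∑ j, W i j = 1)
    (hWcol : ∀ j, ∑ i, W i j = 1)
    (hWdiagpos : ∀ i, 0 < W i i)
    (m M : ℝ) (hm : 0 < m) (hmM : m ≤ M)
    (F : Fin N → EuclideanSpace ℝ (Fin n) → ℝ)
    (hFsmooth : ∀ i, ContDiff ℝ 2 (F i))
    (HF : Fin N → EuclideanSpace ℝ (Fin n) → Matrix (Fin n) (Fin n) ℝ)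
    (hHF : ∀ i y, HasFDerivAt (gradient (F i)) (Matrix.toEuclideanCLM (𝕜 := ℝ) (HF i y)) y)
    (hHFlow : ∀ i y, (HF i y - m • (1 : Matrix (Fin n) (Fin n) ℝ)).PosSemidef)
    (hHFup : ∀ i y, (M • (1 : Matrix (Fin n) (Fin n) ℝ) - HF i y).PosSemidef)
    (α ε : ℝ) (hα : 0 < α) (hε : 0 < ε)
    (x : EuclideanSpace ℝ (Fin N × Fin n))
    (H : Matrix (Fin N × Fin n) (Fin N × Fin n) ℝ)
    (hH : H = blockHess N n HF x
      + α • ((1 : Matrix (Fin N × Fin n) (Fin N × Fin n) ℝ) - WW N n W) + ε • 1)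
    (D G : Matrix (Fin N × Fin n) (Fin N × Fin n) ℝ)
    (hD : D = Matrix.diagonal (fun p => H p p))
    (hG : G = D - H)
    (wd wm : ℝ) (hwd : wd = ⨆ i, W i i) (hwm : wm = ⨅ i, W i i)
 :
    blockNorm (D⁻¹ * H) ≤ (M + ε + α * (1 - wm) + α * (1 - wd)) / (m + α * (1 - wd) + ε) := by
  subst hD
  have : Nonempty (Fin N) := ⟨⟨0, hN⟩⟩
  have hWle (i j) : W i j ≤ 1 :=
    hWrow i ▸ Finset.single_le_sum (fun k _ => hWnonneg i k) (Finset.mem_univ j)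
  have hwm_le (i) : wm ≤ W i i := hwm ▸ ciInf_le (Set.finite_range _).bddBelow i
  have hle_wd (i) : W i i ≤ wd :=
    hwd ▸ le_ciSup (f := fun i => W i i) (Set.finite_range _).bddAbove i
  have hwd1 : wd ≤ 1 := hwd ▸ ciSup_le fun i => hWle i i
  have hdiag_block (i : Fin N) : (Matrix.of fun a b : Fin n => H (i, a) (i, b))
      = HF i (comp N n x i) + (α * (1 - W i i) + ε) • 1 := by
    ext a b
    by_cases hab : a = b <;> simp [hH, blockHess, WW, Matrix.one_apply, hab] <;> ring
  have hoff_block (i j : Fin N) (hij : i ≠ j) :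
      (Matrix.of fun a b : Fin n => H (i, a) (j, b)) = (-(α * W i j)) • 1 := by
    ext a b
    by_cases hab : a = b <;> simp [hH, blockHess, WW, Matrix.one_apply, hij, hab]
  have hentry (i : Fin N) (a : Fin n) : m + α * (1 - W i i) + ε ≤ H (i, a) (i, a) := by
    have h₁ := (hHFlow i (comp N n x i)).diag_nonneg (i := a)
    have h₂ := congrFun (congrFun (hdiag_block i) a) a
    simp at h₁ h₂
    linarith
  have hpos (i : Fin N) : 0 < m + α * (1 - W i i) + ε := by
    have := mul_nonneg hα.le (sub_nonneg.2 (hWle i i))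
    linarith
  have hinv : (Matrix.diagonal fun p => H p p)⁻¹ = Matrix.diagonal fun p => (H p p)⁻¹ := by
    refine Matrix.inv_eq_left_inv ?_
    rw [Matrix.diagonal_mul_diagonal, ← Matrix.diagonal_one]
    congr 1
    ext p
    exact inv_mul_cancel₀ ((hpos p.1).trans_le (hentry p.1 p.2)).ne'
  refine ciSup_le fun i => ?_
  have hscaled (j : Fin N) :
      specNorm (Matrix.of fun a b : Fin n => ((Matrix.diagonal fun p => H p p)⁻¹ * H) (i, a) (j, b))
      ≤ (m + α * (1 - W i i) + ε)⁻¹ * specNorm (Matrix.of fun a b : Fin n => H (i, a) (j, b)) := by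
    have hfactor : (Matrix.of fun a b : Fin n =>
        ((Matrix.diagonal fun p => H p p)⁻¹ * H) (i, a) (j, b))
        = Matrix.diagonal (fun a => (H (i, a) (i, a))⁻¹)
          * Matrix.of fun a b : Fin n => H (i, a) (j, b) := by
      ext a b
      simp [hinv, Matrix.diagonal_mul]
    rw [hfactor]
    refine (specNorm_mul_le _ _).trans (mul_le_mul_of_nonneg_right ?_ (norm_nonneg _))
    refine specNorm_diagonal_le (inv_nonneg.2 (hpos i).le) fun a => ?_
    rw [abs_inv, abs_of_pos ((hpos i).trans_le (hentry i a))]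
    exact inv_anti₀ (hpos i) (hentry i a)
  have hdiag : specNorm (Matrix.of fun a b : Fin n => H (i, a) (i, b))
      ≤ M + α * (1 - W i i) + ε := by
    have hc : 0 ≤ α * (1 - W i i) + ε := by
      have := mul_nonneg hα.le (sub_nonneg.2 (hWle i i))
      linarith
    rw [hdiag_block]
    refine specNorm_le_of_posSemidef (by linarith) ?_ ?_
    · convert (hHFlow i (comp N n x i)).add
        (Matrix.PosSemidef.one.smul (by linarith : 0 ≤ m + (α * (1 - W i i) + ε))) using 1
      module
    · convert hHFup i (comp N n x i) using 1
      module
  have hoff : ∑ j ∈ Finset.univ.erase i, specNorm (Matrix.of fun a b : Fin n => H (i, a) (j, b))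
      ≤ α * (1 - W i i) := by
    calc _ ≤ ∑ j ∈ Finset.univ.erase i, α * W i j := by
          refine Finset.sum_le_sum fun j hj => ?_
          rw [hoff_block i j (Finset.ne_of_mem_erase hj).symm]
          refine (specNorm_smul_one_le _).trans_eq ?_
          rw [abs_neg, abs_of_nonneg (mul_nonneg hα.le (hWnonneg i j))]
      _ = α * (1 - W i i) := by
          rw [← Finset.mul_sum, Finset.sum_erase_eq_sub (Finset.mem_univ i), hWrow]
  have hs : 0 ≤ α * (1 - wd) := mul_nonneg hα.le (sub_nonneg.2 hwd1)
  have hst : α * (1 - wd) ≤ α * (1 - W i i) :=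
    mul_le_mul_of_nonneg_left (by linarith [hle_wd i]) hα.le
  have htu : α * (1 - W i i) ≤ α * (1 - wm) :=
    mul_le_mul_of_nonneg_left (by linarith [hwm_le i]) hα.le
  calc _ ≤ ∑ j, (m + α * (1 - W i i) + ε)⁻¹
        * specNorm (Matrix.of fun a b : Fin n => H (i, a) (j, b)) :=
        Finset.sum_le_sum fun j _ => hscaled j
    _ ≤ (m + α * (1 - W i i) + ε)⁻¹ * (M + α * (1 - W i i) + ε + α * (1 - W i i)) := by
        rw [← Finset.mul_sum, ← Finset.add_sum_erase _ _ (Finset.mem_univ i)]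
        exact mul_le_mul_of_nonneg_left (add_le_add hdiag hoff) (inv_nonneg.2 (hpos i).le)
    _ ≤ _ := by
        rw [inv_mul_eq_div, div_le_div_iff₀ (hpos i) (by linarith)]
        nlinarith [mul_nonneg (sub_nonneg.2 hst) (sub_nonneg.2 hmM),
          mul_nonneg (sub_nonneg.2 hst) (hs.trans hst),
          mul_nonneg (sub_nonneg.2 htu) (hpos i).le]
end
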